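/- Let p ≥ 1 and n ≥ 1 be natural numbers and let u_1 < u_2 < … < u_{n+p+1} be a strictly increasing knot vector. Then for every degree q with 1 ≤ q ≤ p and every i with 1 ≤ i ≤ n+p−q, the B-spline N_{i,q} : ℝ → ℝ defined by the Cox–de Boor recursion is a continuous function on all of ℝ. -/

import Mathlib

/-- The Cox–de Boor recursion: `coxDeBoor u q i x` is the value at `x` of the `i`-th
B-spline `N_{i,q}` of degree `q` over the knots `u`. -/
noncomputable def coxDeBoor (u : ℕ → ℝ) : ℕ → ℕ → ℝ → ℝ
  | 0, i, x => if u i ≤ x ∧ x < u (i + 1) then 1 else 0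
  | q + 1, i, x =>
      (x - u i) / (u (i + q + 1) - u i) * coxDeBoor u q i x +
        (u (i + q + 2) - x) / (u (i + q + 2) - u (i + 1)) * coxDeBoor u q (i + 1) x

/-- Over three increasing knots, the linear B-spline is the hat function. -/
theorem coxDeBoor_one_eq_max_min (u : ℕ → ℝ) (i : ℕ) (h₁ : u i < u (i + 1))
    (h₂ : u (i + 1) < u (i + 2)) (x : ℝ) :
    coxDeBoor u 1 i x =
      max 0 (min ((x - u i) / (u (i + 1) - u i))
        ((u (i + 2) - x) / (u (i + 2) - u (i + 1)))) := by
  have hab : 0 < u (i + 1) - u i := sub_pos.2 h₁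
  have hbc : 0 < u (i + 2) - u (i + 1) := sub_pos.2 h₂
  simp only [coxDeBoor, add_zero, add_assoc, Nat.reduceAdd]
  rcases lt_or_ge x (u i) with hx | hx
  · rw [if_neg (by intro h; linarith [h.1]), if_neg (by intro h; linarith [h.1]),
      max_eq_left (min_le_of_left_le (div_nonpos_of_nonpos_of_nonneg (by linarith) hab.le))]
    ring
  rcases lt_or_ge x (u (i + 1)) with hx' | hx'
  · have hle : (x - u i) / (u (i + 1) - u i) ≤ 1 := (div_le_one hab).2 (by linarith)
    have hge : 1 ≤ (u (i + 2) - x) / (u (i + 2) - u (i + 1)) :=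
      (one_le_div hbc).2 (by linarith)
    rw [if_pos ⟨hx, hx'⟩, if_neg (by intro h; linarith [h.1]), min_eq_left (hle.trans hge),
      max_eq_right (div_nonneg (by linarith) hab.le)]
    ring
  have hge : 1 ≤ (x - u i) / (u (i + 1) - u i) := (one_le_div hab).2 (by linarith)
  have hle : (u (i + 2) - x) / (u (i + 2) - u (i + 1)) ≤ 1 := (div_le_one hbc).2 (by linarith)
  rw [if_neg (by intro h; linarith [h.2]), min_eq_right (hle.trans hge)]
  rcases lt_or_ge x (u (i + 2)) with hx'' | hx''
  · rw [if_pos ⟨hx', hx''⟩, max_eq_right (div_nonneg (by linarith) hbc.le)]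
    ring
  · rw [if_neg (by intro h; linarith [h.2]),
      max_eq_left (div_nonpos_of_nonpos_of_nonneg (by linarith) hbc.le)]
    ring

/-- Continuity of B-splines of degree at least one: over a strictly increasing knot
vector `u_1 < … < u_{n+p+1}`, every B-spline `N_{i,q}` with `1 ≤ q ≤ p` is continuous
on all of `ℝ`. -/
theorem coxDeBoor_continuous (p n : ℕ) (hp : 1 ≤ p) (hn : 1 ≤ n) (u : ℕ → ℝ)
    (hu : StrictMonoOn u (Set.Icc 1 (n + p + 1))) :
    ∀ q, 1 ≤ q → q ≤ p → ∀ i, 1 ≤ i → i ≤ n + p - q →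
      Continuous (fun x : ℝ => coxDeBoor u q i x) := by
  intro q hq
  induction q, hq using Nat.le_induction with
  | base =>
    intro _ i hi hin
    have h₁ : u i < u (i + 1) := hu ⟨by lia, by lia⟩ ⟨by lia, by lia⟩ (by lia)
    have h₂ : u (i + 1) < u (i + 2) := hu ⟨by lia, by lia⟩ ⟨by lia, by lia⟩ (by lia)
    simp only [coxDeBoor_one_eq_max_min u i h₁ h₂]
    fun_prop
  | succ q _ ih =>
    intro hqp i hi hin
    have hl := ih (by lia) i hi (by lia)
    have hr := ih (by lia) (i + 1) (by lia) (by lia)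
    simp only [coxDeBoor]
    fun_prop
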